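/- arXiv:hep-th/0304074 — 4 statements merged into one kernel-verified Lean document; each statement's English description precedes it below -/
import Mathlib

section
/- Let C₀, C₁ be groups, s, t : C₁ → C₀ and idm : C₀ → C₁ group homomorphisms with s(idm(g)) = g and t(idm(g)) = g for all g ∈ C₀. Let K = {(f₁, f₂) ∈ C₁ × C₁ : t(f₁) = s(f₂)} (a subgroup of C₁ × C₁) and let c : K → C₁ be a group homomorphism satisfying c(idm(s(f)), f) = f = c(f, idm(t(f))) for all f ∈ C₁. Then the vertical composition c is completely determined by the remaining structure: for all h₁, h₂ ∈ ker s and g₁, g₂ ∈ C₀ with t(h₁)·g₁ = g₂ (so that the pair is composable), c(h₁ · idm(g₁), h₂ · idm(g₂)) = h₂ · h₁ · idm(g₁). -/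
/-- The subgroup of composable pairs `{(f₁, f₂) : t f₁ = s f₂}` of `C₁ × C₁`. -/
def composablePairs {C₀ C₁ : Type*} [Group C₀] [Group C₁]
    (s t : C₁ →* C₀) : Subgroup (C₁ × C₁) where
  carrier := {p | t p.1 = s p.2}
  mul_mem' := by
    intro a b ha hb
    simp only [Set.mem_setOf_eq, Prod.fst_mul, Prod.snd_mul, map_mul] at *
    rw [ha, hb]
  one_mem' := by simp
  inv_mem' := by
    intro a ha
    simp only [Set.mem_setOf_eq, Prod.fst_inv, Prod.snd_inv, map_inv] at *
    rw [ha]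

/-- In a strict 2-group (internal category in groups), the vertical composition
`c` is completely determined by the remaining structure: on composable pairs,
`c (h₁ * idm g₁, h₂ * idm g₂) = h₂ * h₁ * idm g₁` for `h₁, h₂ ∈ ker s`. -/
theorem stmt3_vertical_composition_determined {C₀ C₁ : Type*} [Group C₀] [Group C₁]
    (s t : C₁ →* C₀) (idm : C₀ →* C₁)
    (hsi : ∀ g : C₀, s (idm g) = g) (hti : ∀ g : C₀, t (idm g) = g)
    (c : composablePairs s t →* C₁)
    (hc_left : ∀ (f : C₁) (hf : (idm (s f), f) ∈ composablePairs s t),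
      c ⟨(idm (s f), f), hf⟩ = f)
    (hc_right : ∀ (f : C₁) (hf : (f, idm (t f)) ∈ composablePairs s t),
      c ⟨(f, idm (t f)), hf⟩ = f) :
    ∀ (h₁ h₂ : C₁), h₁ ∈ s.ker → h₂ ∈ s.ker → ∀ (g₁ g₂ : C₀), t h₁ * g₁ = g₂ →
      ∀ hmem : (h₁ * idm g₁, h₂ * idm g₂) ∈ composablePairs s t,
        c ⟨(h₁ * idm g₁, h₂ * idm g₂), hmem⟩ = h₂ * h₁ * idm g₁ := by
  rintro h₁ h₂ - hh₂ g₁ g₂ rfl hmem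
  have hs : s h₂ = 1 := hh₂
  have hl : (idm (s h₂), h₂) ∈ composablePairs s t := by
    change t (idm (s h₂)) = s h₂
    rw [hti]
  have hr : (h₁ * idm g₁, idm (t (h₁ * idm g₁))) ∈ composablePairs s t := by
    change t (h₁ * idm g₁) = s (idm (t (h₁ * idm g₁)))
    rw [hsi]
  have key : (⟨(h₁ * idm g₁, h₂ * idm (t h₁ * g₁)), hmem⟩ : composablePairs s t) =
      ⟨(idm (s h₂), h₂), hl⟩ * ⟨(h₁ * idm g₁, idm (t (h₁ * idm g₁))), hr⟩ := by
    ext <;> simp [hs, hti]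
  rw [key, map_mul, hc_left, hc_right, mul_assoc]
end

section
/- Let C₀, C₁ be groups, s, t : C₁ → C₀ and idm : C₀ → C₁ group homomorphisms with s(idm(g)) = g and t(idm(g)) = g for all g ∈ C₀. Let K = {(f₁, f₂) ∈ C₁ × C₁ : t(f₁) = s(f₂)} (a subgroup of C₁ × C₁) and let c : K → C₁ be a group homomorphism satisfying c(idm(s(f)), f) = f = c(f, idm(t(f))) for all f ∈ C₁. Then the Peiffer identity holds on ker s: for all h, h' ∈ ker s, idm(t(h)) · h' · idm(t(h))⁻¹ = h · h' · h⁻¹. In particular, (C₀, ker s, t|_{ker s}, α) with α(g)[h] = idm(g)·h·idm(g)⁻¹ is a crossed module. -/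
/-- In an internal category in groups, `ker t` and `ker s` commute elementwise. -/
theorem mul_comm_of_mem_ker {C₀ C₁ : Type*} [Group C₀] [Group C₁]
    (s t : C₁ →* C₀) (idm : C₀ →* C₁) (c : composablePairs s t →* C₁)
    (hc_left : ∀ (f : C₁) (hf : (idm (s f), f) ∈ composablePairs s t),
      c ⟨(idm (s f), f), hf⟩ = f)
    (hc_right : ∀ (f : C₁) (hf : (f, idm (t f)) ∈ composablePairs s t),
      c ⟨(f, idm (t f)), hf⟩ = f)
    {a b : C₁} (ha : a ∈ t.ker) (hb : b ∈ s.ker) : a * b = b * a := by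
  rw [MonoidHom.mem_ker] at ha hb
  have hma : (a, 1) ∈ composablePairs s t := by
    change t a = s 1
    rw [ha, map_one]
  have hmb : (1, b) ∈ composablePairs s t := by
    change t 1 = s b
    rw [hb, map_one]
  have hca : c ⟨(a, 1), hma⟩ = a := by
    have h := hc_right a
    simp only [ha, map_one] at h
    exact h hma
  have hcb : c ⟨(1, b), hmb⟩ = b := by
    have h := hc_left b
    simp only [hb, map_one] at h
    exact h hmb
  have hcomm : (⟨(a, 1), hma⟩ : composablePairs s t) * ⟨(1, b), hmb⟩ =
      ⟨(1, b), hmb⟩ * ⟨(a, 1), hma⟩ := by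
    ext <;> simp
  simpa only [map_mul, hca, hcb] using congrArg c hcomm

/-- In a strict 2-group (internal category in groups), the Peiffer identity
holds on `ker s`, so that `(C₀, ker s, t|ker s, α)` with
`α g h = idm g * h * (idm g)⁻¹` is a crossed module. -/
theorem stmt4_peiffer_identity {C₀ C₁ : Type*} [Group C₀] [Group C₁]
    (s t : C₁ →* C₀) (idm : C₀ →* C₁)
    (hsi : ∀ g : C₀, s (idm g) = g) (hti : ∀ g : C₀, t (idm g) = g)
    (c : composablePairs s t →* C₁)
    (hc_left : ∀ (f : C₁) (hf : (idm (s f), f) ∈ composablePairs s t),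
      c ⟨(idm (s f), f), hf⟩ = f)
    (hc_right : ∀ (f : C₁) (hf : (f, idm (t f)) ∈ composablePairs s t),
      c ⟨(f, idm (t f)), hf⟩ = f) :
    -- the action `α g h = idm g * h * (idm g)⁻¹` preserves `ker s`,
    (∀ g : C₀, ∀ h ∈ s.ker, idm g * h * (idm g)⁻¹ ∈ s.ker) ∧
    -- it is equivariant: `t (α g h) = g * t h * g⁻¹`,
    (∀ g : C₀, ∀ h ∈ s.ker, t (idm g * h * (idm g)⁻¹) = g * t h * g⁻¹) ∧
    -- and the Peiffer identity holds on `ker s`: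
    (∀ h h' : C₁, h ∈ s.ker → h' ∈ s.ker →
      idm (t h) * h' * (idm (t h))⁻¹ = h * h' * h⁻¹) := by
  refine ⟨fun g h hh => ?_, fun g h _ => ?_, fun h h' _ hh' => ?_⟩
  · exact s.normal_ker.conj_mem h hh (idm g)
  · simp only [map_mul, map_inv, hti]
  · have hker : h⁻¹ * idm (t h) ∈ t.ker := by
      simp only [MonoidHom.mem_ker, map_mul, map_inv, hti, inv_mul_cancel]
    have hcomm := mul_comm_of_mem_ker s t idm c hc_left hc_right hker hh'
    rw [mul_inv_eq_iff_eq_mul]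
    calc idm (t h) * h' = h * (h⁻¹ * idm (t h) * h') := by group
      _ = h * (h' * (h⁻¹ * idm (t h))) := by rw [hcomm]
      _ = h * h' * h⁻¹ * idm (t h) := by group
end

section
/- Let (G, H, t, α) be a crossed module. Let g₁₂, g₁₃, g₁₄, g₂₃, g₂₄, g₃₄ ∈ G and h₁₂₃, h₁₂₄, h₁₃₄, h₂₃₄ ∈ H satisfy the four triangle conditions t(h₁₂₃)·g₁₂·g₂₃ = g₁₃, t(h₁₂₄)·g₁₂·g₂₄ = g₁₄, t(h₁₃₄)·g₁₃·g₃₄ = g₁₄ and t(h₂₃₄)·g₂₃·g₃₄ = g₂₄ (the labelled faces of a tetrahedron). Then the four 2-morphisms (h₁₂₄⁻¹, g₁₄), (α(g₁₂)[h₂₃₄⁻¹], g₁₂·g₂₄), (h₁₂₃, g₁₂·g₂₃·g₃₄), (h₁₃₄, g₁₃·g₃₄) are successively vertically composable (each target t(h)·g equals the next source g), their vertical composite, the 2-holonomy, equals Φ₁₂₃₄ = (h₁₃₄ · h₁₂₃ · α(g₁₂)[h₂₃₄⁻¹] · h₁₂₄⁻¹, g₁₄), and its H-component lies in the kernel of t: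 t(h₁₃₄ · h₁₂₃ · α(g₁₂)[h₂₃₄⁻¹] · h₁₂₄⁻¹) = 1, so the 2-holonomy has equal source and target g₁₄. -/
/-- Vertical composition on `H ⋊[α] G`:
`(h₁, g₁) ∘ (h₂, g₂) = (h₂ * h₁, g₁)`, defined whenever `g₂ = t h₁ * g₁`. -/
def vcomp {G H : Type*} [Group G] [Group H] {α : G →* MulAut H}
    (a b : H ⋊[α] G) : H ⋊[α] G :=
  ⟨b.left * a.left, a.right⟩

/-- For a crossed module `(G, H, t, α)` and labelled faces of a tetrahedron,
the four 2-morphisms `(h₁₂₄⁻¹, g₁₄)`, `(α(g₁₂)[h₂₃₄⁻¹], g₁₂·g₂₄)`,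
`(h₁₂₃, g₁₂·g₂₃·g₃₄)`, `(h₁₃₄, g₁₃·g₃₄)` are successively vertically
composable, their vertical composite (the 2-holonomy) equals
`(h₁₃₄ · h₁₂₃ · α(g₁₂)[h₂₃₄⁻¹] · h₁₂₄⁻¹, g₁₄)`, and its `H`-component lies in
the kernel of `t`. -/
theorem stmt12_two_holonomy {G H : Type*} [Group G] [Group H]
    (t : H →* G) (α : G →* MulAut H)
    (h_equiv : ∀ (g : G) (h : H), t (α g h) = g * t h * g⁻¹)
    (h_peiffer : ∀ h h' : H, α (t h) h' = h * h' * h⁻¹)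
    (g₁₂ g₁₃ g₁₄ g₂₃ g₂₄ g₃₄ : G) (h₁₂₃ h₁₂₄ h₁₃₄ h₂₃₄ : H)
    (h123 : t h₁₂₃ * g₁₂ * g₂₃ = g₁₃)
    (h124 : t h₁₂₄ * g₁₂ * g₂₄ = g₁₄)
    (h134 : t h₁₃₄ * g₁₃ * g₃₄ = g₁₄)
    (h234 : t h₂₃₄ * g₂₃ * g₃₄ = g₂₄) :
    -- successive composability (each target equals the next source):
    (g₁₂ * g₂₄ = t h₁₂₄⁻¹ * g₁₄) ∧
    (g₁₂ * g₂₃ * g₃₄ = t (α g₁₂ h₂₃₄⁻¹) * (g₁₂ * g₂₄)) ∧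
    (g₁₃ * g₃₄ = t h₁₂₃ * (g₁₂ * g₂₃ * g₃₄)) ∧
    -- the 2-holonomy:
    (vcomp (vcomp (vcomp (⟨h₁₂₄⁻¹, g₁₄⟩ : H ⋊[α] G)
          ⟨α g₁₂ h₂₃₄⁻¹, g₁₂ * g₂₄⟩)
          ⟨h₁₂₃, g₁₂ * g₂₃ * g₃₄⟩)
          ⟨h₁₃₄, g₁₃ * g₃₄⟩ =
      (⟨h₁₃₄ * h₁₂₃ * α g₁₂ h₂₃₄⁻¹ * h₁₂₄⁻¹, g₁₄⟩ : H ⋊[α] G)) ∧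
    -- its `H`-component lies in `ker t`, so source and target agree:
    (t (h₁₃₄ * h₁₂₃ * α g₁₂ h₂₃₄⁻¹ * h₁₂₄⁻¹) = 1) := by
  subst h123 h234 h124
  refine ⟨by simp [mul_assoc], by simp [h_equiv, mul_assoc], by simp [mul_assoc],
    by simp [vcomp, mul_assoc], ?_⟩
  have key : t h₁₃₄ * t h₁₂₃ = t h₁₂₄ * g₁₂ * t h₂₃₄ * g₁₂⁻¹ := by
    rw [eq_mul_inv_iff_mul_eq]
    apply mul_right_cancel (b := g₂₃ * g₃₄)
    simpa only [mul_assoc] using h134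
  simp only [map_mul, map_inv, h_equiv, key]
  group
end

section
/- Let (G, H, t, α) be a crossed module and let s₀ : H → ℝ satisfy s₀(h'·h·h'⁻¹) = s₀(h) and s₀(α(g)[h]) = s₀(h) for all h ∈ H with t(h) = 1, all h' ∈ H and all g ∈ G. Let h ∈ H with t(h) = 1, g, η₁, η₄ ∈ G and k ∈ H, and define the gauge-transformed 2-holonomy Φ̃ := (1, η₁⁻¹) · ( ((k, g·η₄)* ∘ ((h, g)·(1, η₄))) ∘ (k, g·η₄) ) in H ⋊ G, where ∘ is the vertical composition and * the vertical inverse. Then all the vertical compositions occurring are defined, Φ̃ = (α(η₁⁻¹)[k·h·k⁻¹], η₁⁻¹·t(k)·g·η₄), the H-component of Φ̃ lies in ker t, and the 2-action is gauge invariant: s₀(α(η₁⁻¹)[k·h·k⁻¹]) = s₀(h), i.e. S(Φ̃) = S(h, g) for S(h, g) = s₀(h). -/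
/-- Vertical inverse on `H ⋊[α] G`: `(h, g)* = (h⁻¹, t h * g)`. -/
def vinv {G H : Type*} [Group G] [Group H] {α : G →* MulAut H}
    (t : H →* G) (a : H ⋊[α] G) : H ⋊[α] G :=
  ⟨a.left⁻¹, t a.left * a.right⟩

/-- Gauge invariance of the 2-action: for a crossed module `(G, H, t, α)`, a
2-holonomy `(h, g)` with `h ∈ ker t`, and gauge data `η₁, η₄ ∈ G`,
`k ∈ H`, the gauge-transformed 2-holonomy
`Φ̃ = (1, η₁⁻¹) · (((k, g·η₄)* ∘ ((h, g)·(1, η₄))) ∘ (k, g·η₄))`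
is defined, equals `(α(η₁⁻¹)[k·h·k⁻¹], η₁⁻¹·t k·g·η₄)`, has `H`-component in
`ker t`, and satisfies `S(Φ̃) = S(h, g)` for any admissible 2-action `S`. -/
theorem stmt15_gauge_invariance {G H : Type*} [Group G] [Group H]
    (t : H →* G) (α : G →* MulAut H)
    (h_equiv : ∀ (g : G) (h : H), t (α g h) = g * t h * g⁻¹)
    (h_peiffer : ∀ h h' : H, α (t h) h' = h * h' * h⁻¹)
    (s₀ : H → ℝ)
    (h_class : ∀ h : H, t h = 1 → ∀ h' : H, s₀ (h' * h * h'⁻¹) = s₀ h)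
    (h_orbit : ∀ (g : G) (h : H), t h = 1 → s₀ (α g h) = s₀ h)
    (h : H) (hker : t h = 1) (g η₁ η₄ : G) (k : H) :
    -- composability of the first vertical composition:
    (((⟨h, g⟩ : H ⋊[α] G) * ⟨1, η₄⟩).right =
      t ((vinv t (⟨k, g * η₄⟩ : H ⋊[α] G)).left) *
        (vinv t (⟨k, g * η₄⟩ : H ⋊[α] G)).right) ∧
    -- composability of the second vertical composition:
    (g * η₄ =
      t ((vcomp (vinv t (⟨k, g * η₄⟩ : H ⋊[α] G))
            ((⟨h, g⟩ : H ⋊[α] G) * ⟨1, η₄⟩)).left) *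
        (vcomp (vinv t (⟨k, g * η₄⟩ : H ⋊[α] G))
            ((⟨h, g⟩ : H ⋊[α] G) * ⟨1, η₄⟩)).right) ∧
    -- the gauge-transformed 2-holonomy:
    ((⟨1, η₁⁻¹⟩ : H ⋊[α] G) *
        vcomp (vcomp (vinv t (⟨k, g * η₄⟩ : H ⋊[α] G))
            ((⟨h, g⟩ : H ⋊[α] G) * ⟨1, η₄⟩)) ⟨k, g * η₄⟩ =
      (⟨α η₁⁻¹ (k * h * k⁻¹), η₁⁻¹ * t k * g * η₄⟩ : H ⋊[α] G)) ∧
    -- its `H`-component lies in `ker t`: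
    (t (α η₁⁻¹ (k * h * k⁻¹)) = 1) ∧
    -- gauge invariance of the 2-action:
    (s₀ (α η₁⁻¹ (k * h * k⁻¹)) = s₀ h) := by
  have hconj : t (k * h * k⁻¹) = 1 := by simp [hker]
  refine ⟨?_, ?_, ?_, ?_, ?_⟩
  · simp [vinv]
  · simp [vinv, vcomp, hker]
  · ext <;> simp [vinv, vcomp, mul_assoc]
  · rw [h_equiv, hconj, mul_one, mul_inv_cancel]
  · rw [h_orbit _ _ hconj, h_class h hker]
end
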